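/- arXiv:1910.02887 — 4 statements merged into one kernel-verified Lean document; each statement's English description precedes it below -/
import Mathlib

section
/- Let d ≥ 1 and 0 < i ≤ d. Then the function ℒ_i^d(s) := −∫₀^∞ ((−1−e^{−4t})^{d−i} e^{−s²t} e^{−2it} I₀(2t)^i − (−2)^{d−i} e^{−t}) dt/t is well defined for every real s > 0 (the integral converges absolutely), and ℒ_i^d(s) − (−2)^{d−i} log(s²) tends to 0 as s → +∞. -/
open Real Filter Finset MeasureTheory

/-- The modified Bessel function of the first kind of order zero. -/
noncomputable def besselI0 (x : ℝ) : ℝ :=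
  (1 / Real.pi) * ∫ θ in (0:ℝ)..Real.pi, Real.exp (x * Real.cos θ)

/-- The integrand of `ℒ_i^d(s)`. -/
noncomputable def Lintegrand (d i : ℕ) (s t : ℝ) : ℝ :=
  ((-1 - Real.exp (-4 * t)) ^ (d - i) * Real.exp (-s ^ 2 * t) * Real.exp (-2 * i * t) *
      (besselI0 (2 * t)) ^ i - (-2 : ℝ) ^ (d - i) * Real.exp (-t)) / t

/-- The function `ℒ_i^d(s)`. -/
noncomputable def Lfun (d i : ℕ) (s : ℝ) : ℝ :=
  -∫ t in Set.Ioi (0:ℝ), Lintegrand d i s t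

/-- Normalised Bessel factor `e^{-2t} I₀(2t)`. -/
noncomputable def hfac (t : ℝ) : ℝ := Real.exp (-2 * t) * besselI0 (2 * t)

lemma hfac_continuous : Continuous hfac := by
  have h : Continuous (fun t : ℝ => ∫ θ in (0:ℝ)..Real.pi, Real.exp ((2 * t) * Real.cos θ)) := by
    apply intervalIntegral.continuous_parametric_intervalIntegral_of_continuous'
    fun_prop
  unfold hfac besselI0
  fun_prop

lemma hfac_eq (t : ℝ) :
    hfac t = (1 / Real.pi) * ∫ θ in (0:ℝ)..Real.pi, Real.exp (2 * t * (Real.cos θ - 1)) := by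
  unfold hfac besselI0
  have : ∀ θ : ℝ, Real.exp (2 * t * (Real.cos θ - 1))
      = Real.exp (-2 * t) * Real.exp (2 * t * Real.cos θ) := by
    intro θ
    rw [← Real.exp_add]; congr 1; ring
  simp_rw [this, intervalIntegral.integral_const_mul]
  ring

lemma hfac_nonneg (t : ℝ) : 0 ≤ hfac t := by
  rw [hfac_eq]
  have := intervalIntegral.integral_nonneg (μ := volume) Real.pi_pos.le
    (f := fun θ => Real.exp (2 * t * (Real.cos θ - 1))) (fun u _ => (Real.exp_pos _).le)
  positivity

lemma hfac_le_one (t : ℝ) (ht : 0 ≤ t) : hfac t ≤ 1 := by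
  rw [hfac_eq]
  have h := intervalIntegral.integral_mono (μ := volume) Real.pi_pos.le
    (f := fun θ => Real.exp (2 * t * (Real.cos θ - 1))) (g := fun _ => (1:ℝ))
    (Continuous.intervalIntegrable (by fun_prop) _ _)
    (Continuous.intervalIntegrable (by fun_prop) _ _)
    (fun u => by
      have := Real.cos_le_one u
      simp only [Real.exp_le_one_iff]
      nlinarith)
  simp only [intervalIntegral.integral_const, sub_zero, smul_eq_mul, mul_one] at h
  rw [one_div, inv_mul_le_iff₀ Real.pi_pos]
  linarith

lemma hfac_ge (t : ℝ) (ht : 0 ≤ t) : 1 - 4 * t ≤ hfac t := by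
  rw [hfac_eq]
  have h := intervalIntegral.integral_mono (μ := volume) Real.pi_pos.le
    (g := fun θ => Real.exp (2 * t * (Real.cos θ - 1))) (f := fun _ => (1 - 4 * t:ℝ))
    (Continuous.intervalIntegrable (by fun_prop) _ _)
    (Continuous.intervalIntegrable (by fun_prop) _ _)
    (fun u => by
      have := Real.neg_one_le_cos u
      have h2 := Real.add_one_le_exp (2 * t * (Real.cos u - 1))
      simp only
      nlinarith)
  simp only [intervalIntegral.integral_const, sub_zero, smul_eq_mul] at h
  rw [one_div, le_inv_mul_iff₀ Real.pi_pos]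
  linarith

lemma pow_ge_aux (u x : ℝ) (hu : 0 ≤ u) (hux : 1 - x ≤ u) (n : ℕ) : 1 - n * x ≤ u ^ n := by
  have h := one_add_mul_le_pow (a := u - 1) (by linarith) n
  have h2 : (n : ℝ) * (1 - x) ≤ n * u := by gcongr
  rw [show 1 + (u - 1) = u by ring] at h
  linarith

/-- The normalised smooth factor. -/
noncomputable def wfac (n i : ℕ) (t : ℝ) : ℝ := ((1 + Real.exp (-4 * t)) / 2) ^ n * hfac t ^ i

lemma wfac_continuous (n i : ℕ) : Continuous (wfac n i) := by
  have := hfac_continuous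
  unfold wfac
  fun_prop

lemma wfac_bound (n i : ℕ) (t : ℝ) (ht : 0 ≤ t) :
    |wfac n i t - 1| ≤ (4 * n + 4 * i) * t := by
  unfold wfac
  set u := (1 + Real.exp (-4 * t)) / 2 with hu
  have e0 := Real.exp_pos (-4 * t)
  have e1 : Real.exp (-4 * t) ≤ 1 := by rw [Real.exp_le_one_iff]; linarith
  have e2 := Real.add_one_le_exp (-4 * t)
  have u0 : 0 ≤ u := by positivity
  have u1 : u ≤ 1 := by linarith
  have hun := pow_ge_aux u (4 * t) u0 (by linarith) n
  have hhi := pow_ge_aux (hfac t) (4 * t) (hfac_nonneg t) (hfac_ge t ht) i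
  have a1 := pow_le_one₀ (n := n) u0 u1
  have a2 := pow_le_one₀ (n := i) (hfac_nonneg t) (hfac_le_one t ht)
  have a3 := pow_nonneg u0 n
  have a4 := pow_nonneg (hfac_nonneg t) i
  rw [abs_le]
  constructor <;> nlinarith [mul_nonneg (sub_nonneg.2 a1) (sub_nonneg.2 a2)]

lemma Lintegrand_eq (d i : ℕ) (s t : ℝ) :
    Lintegrand d i s t = (-2 : ℝ) ^ (d - i) *
      (Real.exp (-s ^ 2 * t) * (wfac (d - i) i t - 1) / t
        + t⁻¹ • (Real.exp (-(s ^ 2 * t)) - Real.exp (-(1 * t)))) := by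
  have h1 : (-1 - Real.exp (-4 * t)) ^ (d - i)
      = (-2 : ℝ) ^ (d - i) * ((1 + Real.exp (-4 * t)) / 2) ^ (d - i) := by
    rw [← mul_pow]; congr 1; ring
  have h2 : Real.exp (-2 * i * t) = Real.exp (-2 * t) ^ i := by
    rw [← Real.exp_nat_mul]; congr 1; ring
  unfold Lintegrand wfac hfac
  rw [h1, h2, mul_pow, smul_eq_mul, neg_mul, one_mul]
  ring

lemma exp_int (a : ℝ) (ha : 0 < a) :
    IntegrableOn (fun t : ℝ => Real.exp (-a * t)) (Set.Ioi 0) :=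
  integrableOn_exp_mul_Ioi (by linarith) 0

lemma first_bound (n i : ℕ) (s t : ℝ) (ht : 0 < t) :
    ‖Real.exp (-s ^ 2 * t) * (wfac n i t - 1) / t‖
      ≤ (4 * n + 4 * i) * Real.exp (-s ^ 2 * t) := by
  have h := wfac_bound n i t ht.le
  have e := Real.exp_pos (-s ^ 2 * t)
  rw [Real.norm_eq_abs, abs_div, abs_mul, abs_of_pos ht, abs_of_pos e, div_le_iff₀ ht]
  nlinarith

lemma first_int (n i : ℕ) (s : ℝ) (hs : 0 < s) :
    IntegrableOn (fun t => Real.exp (-s ^ 2 * t) * (wfac n i t - 1) / t) (Set.Ioi 0) := by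
  have hg := (exp_int (s ^ 2) (by positivity)).const_mul (4 * n + 4 * i : ℝ)
  refine Integrable.mono' hg ?_ ?_
  · have := (wfac_continuous n i).measurable
    exact Measurable.aestronglyMeasurable (by fun_prop)
  · filter_upwards [ae_restrict_mem measurableSet_Ioi] with t ht
    exact first_bound n i s t ht

lemma first_integral_bound (n i : ℕ) (s : ℝ) (hs : 0 < s) :
    ‖∫ t in Set.Ioi (0:ℝ), Real.exp (-s ^ 2 * t) * (wfac n i t - 1) / t‖
      ≤ (4 * n + 4 * i) * (s ^ 2)⁻¹ := by
  have hg := (exp_int (s ^ 2) (by positivity)).const_mul (4 * n + 4 * i : ℝ)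
  refine (norm_integral_le_of_norm_le hg ?_).trans ?_
  · filter_upwards [ae_restrict_mem measurableSet_Ioi] with t ht
    exact first_bound n i s t ht
  · have hs2 : 0 < s ^ 2 := by positivity
    rw [integral_const_mul, integral_exp_mul_Ioi (by linarith) 0]
    apply le_of_eq
    simp

lemma second_int (a b : ℝ) (ha : 0 < a) (hb : 0 < b) :
    IntegrableOn (fun t : ℝ => t⁻¹ • (Real.exp (-(a * t)) - Real.exp (-(b * t))))
      (Set.Ioi 0) := by
  have hg := ((exp_int a ha).add (exp_int b hb)).const_mul |b - a|
  refine Integrable.mono' hg ?_ ?_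
  · exact Measurable.aestronglyMeasurable (by fun_prop)
  · filter_upwards [ae_restrict_mem measurableSet_Ioi] with t ht
    have ht : 0 < t := ht
    have key : ∀ x y : ℝ, Real.exp (-(x * t)) - Real.exp (-(y * t))
        ≤ Real.exp (-(x * t)) * ((y - x) * t) := by
      intro x y
      have h1 := Real.add_one_le_exp (-((y - x) * t))
      have h2 : Real.exp (-(y * t)) = Real.exp (-(x * t)) * Real.exp (-((y - x) * t)) := by
        rw [← Real.exp_add]; congr 1; ring
      rw [h2]
      nlinarith [Real.exp_pos (-(x * t))]
    have k1 := key a b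
    have k2 := key b a
    have e1 := Real.exp_pos (-(a * t))
    have e2 := Real.exp_pos (-(b * t))
    simp only [Pi.add_apply, neg_mul]
    rw [smul_eq_mul, norm_mul, norm_inv, Real.norm_of_nonneg ht.le, inv_mul_le_iff₀ ht,
      Real.norm_eq_abs, abs_le]
    have m1 : Real.exp (-(a * t)) * ((b - a) * t) ≤ Real.exp (-(a * t)) * (|b - a| * t) := by
      gcongr; exact le_abs_self _
    have m2 : Real.exp (-(b * t)) * ((a - b) * t) ≤ Real.exp (-(b * t)) * (|b - a| * t) := by
      gcongr; rw [abs_sub_comm]; exact le_abs_self _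
    have p1 : 0 ≤ Real.exp (-(a * t)) * (|b - a| * t) := by positivity
    have p2 : 0 ≤ Real.exp (-(b * t)) * (|b - a| * t) := by positivity
    constructor <;> linarith

lemma second_integral (a b : ℝ) (ha : 0 < a) (hb : 0 < b) :
    ∫ t in Set.Ioi (0:ℝ), t⁻¹ • (Real.exp (-(a * t)) - Real.exp (-(b * t)))
      = Real.log (b / a) := by
  have hc : Continuous (fun x : ℝ => Real.exp (-x)) := by fun_prop
  have h := Frullani.integral_Ioi_eq (f := fun x : ℝ => Real.exp (-x)) (L := 1) (R := 0)
    (hc.locallyIntegrable.locallyIntegrableOn _) ha hb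
    (by
      have := hc.tendsto 0
      simp only [neg_zero, Real.exp_zero] at this
      exact this.mono_left nhdsWithin_le_nhds)
    Real.tendsto_exp_neg_atTop_nhds_zero (second_int a b ha hb)
  simpa using h

theorem Lfun_well_defined_and_asymptotics (d i : ℕ) (hd : 1 ≤ d) (hi : 1 ≤ i) (hid : i ≤ d) :
    (∀ s : ℝ, 0 < s → IntegrableOn (fun t => Lintegrand d i s t) (Set.Ioi 0)) ∧
    Filter.Tendsto (fun s : ℝ => Lfun d i s - (-2 : ℝ) ^ (d - i) * Real.log (s ^ 2))
      atTop (nhds 0) := by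
  constructor
  · intro s hs
    simp_rw [Lintegrand_eq]
    exact ((first_int (d - i) i s hs).add
      (second_int (s ^ 2) 1 (by positivity) one_pos)).const_mul _
  · have hlim : Tendsto (fun s : ℝ => (4 * ((d - i : ℕ) : ℝ) + 4 * i) * (s ^ 2)⁻¹)
        atTop (nhds 0) := by
      have h : Tendsto (fun s : ℝ => (s ^ 2)⁻¹) atTop (nhds 0) :=
        tendsto_inv_atTop_zero.comp (tendsto_pow_atTop two_ne_zero)
      simpa using h.const_mul (4 * ((d - i : ℕ) : ℝ) + 4 * i)
    have hF : Tendsto (fun s : ℝ => ∫ t in Set.Ioi (0:ℝ),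
        Real.exp (-s ^ 2 * t) * (wfac (d - i) i t - 1) / t) atTop (nhds 0) := by
      refine squeeze_zero_norm' ?_ hlim
      filter_upwards [eventually_gt_atTop 0] with s hs
      exact first_integral_bound (d - i) i s hs
    have hF2 := hF.const_mul (-(-2 : ℝ) ^ (d - i))
    rw [mul_zero] at hF2
    refine hF2.congr' ?_
    filter_upwards [eventually_gt_atTop 0] with s hs
    unfold Lfun
    simp_rw [Lintegrand_eq]
    rw [integral_const_mul, integral_add (first_int (d - i) i s hs)
      (second_int (s ^ 2) 1 (by positivity) one_pos),
      second_integral (s ^ 2) 1 (by positivity) one_pos, one_div, Real.log_inv]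
    ring
end

section
/- Let d ≥ 1, let a_1,…,a_d > 0, and for each i let n_i : (0,∞) → ℕ∖{0} satisfy n_i(u)/u → a_i as u → ∞. Then for each fixed t > 0, Θ_{L_d(N(u))}(u² t) → θ_{K_d(A)}(t) as u → ∞, where N(u) = (n_1(u),…,n_d(u)). -/
open Real Filter Finset

/-- Theta function of the discrete Laplacian on the discrete hypercube `L_d(N)`
with Dirichlet boundary condition. -/
noncomputable def ThetaL (d : ℕ) (n : Fin d → ℕ) (t : ℝ) : ℝ :=
  ∑ q : (∀ i : Fin d, Fin (n i - 1)),
    Real.exp (-t * (2 * (d : ℝ) -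
      2 * ∑ i, Real.cos (Real.pi * (((q i : ℕ) : ℝ) + 1) / (n i : ℝ))))

/-- Theta function of the Dirichlet Laplacian on the hypercube `K_d(a)`. -/
noncomputable def thetaK (d : ℕ) (a : Fin d → ℝ) (t : ℝ) : ℝ :=
  ∑' q : Fin d → ℕ+, Real.exp (-t * ∑ i, ((q i : ℕ) : ℝ)^2 * Real.pi^2 / (a i)^2)

theorem summable_gauss_aux (c : ℝ) (hc : 0 < c) :
    Summable (fun k : ℕ => Real.exp (-c * ((k : ℝ) + 1) ^ 2)) := by
  have h : Summable (fun k : ℕ => Real.exp ((k : ℝ) * (-c))) :=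
    Real.summable_exp_nat_mul_iff.mpr (by linarith)
  refine Summable.of_nonneg_of_le (fun k => (Real.exp_pos _).le) (fun k => ?_) h
  apply Real.exp_le_exp.mpr
  have hk : (0 : ℝ) ≤ k := Nat.cast_nonneg k
  nlinarith [mul_nonneg hc.le hk, mul_nonneg hc.le (sq_nonneg (k : ℝ))]

theorem hasSum_pi_aux {β : Type} : ∀ (d : ℕ) (f : Fin d → β → ℝ) (s : Fin d → ℝ)
    (_ : ∀ i b, 0 ≤ f i b) (_ : ∀ i, HasSum (f i) (s i)),
    HasSum (fun q : Fin d → β => ∏ i, f i (q i)) (∏ i, s i)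
  | 0, f, s, h0, hs => by
    simp
  | d + 1, f, s, h0, hs => by
    have ih := hasSum_pi_aux d (fun i => f i.succ) (fun i => s i.succ)
      (fun i => h0 i.succ) (fun i => hs i.succ)
    have hsum := (hs 0).summable.mul_of_nonneg ih.summable (h0 0)
      (fun q => Finset.prod_nonneg (fun i _ => h0 i.succ (q i)))
    have hm := (hs 0).mul ih hsum
    rw [Fin.prod_univ_succ]
    refine (Equiv.hasSum_iff (Fin.consEquiv (fun _ : Fin (d + 1) => β))).mp ?_
    have he : ((fun q : Fin (d + 1) → β => ∏ i, f i (q i)) ∘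
        (Fin.consEquiv (fun _ : Fin (d + 1) => β))) =
        fun x : β × (Fin d → β) => f 0 x.1 * ∏ i : Fin d, f i.succ (x.2 i) := by
      funext x
      simp [Fin.prod_univ_succ, Fin.consEquiv]
    rw [he]
    exact hm

theorem two_sub_two_cos_aux (x : ℝ) : 2 - 2 * Real.cos x = 4 * Real.sin (x / 2) ^ 2 := by
  have h := Real.cos_sq (x / 2)
  rw [show 2 * (x / 2) = x by ring] at h
  have h2 := Real.sin_sq_add_cos_sq (x / 2)
  linarith

theorem sin_eq_mul_sinc_aux (x : ℝ) : Real.sin x = x * Real.sinc x := by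
  by_cases h : x = 0
  · simp [h]
  · rw [Real.sinc_of_ne_zero h]; field_simp

theorem one_dim_aux (a : ℝ) (ha : 0 < a) (n : ℝ → ℕ+)
    (hn : Tendsto (fun u : ℝ => ((n u : ℕ) : ℝ) / u) atTop (nhds a)) (t : ℝ) (ht : 0 < t) :
    Tendsto (fun u : ℝ => ∑ k : Fin ((n u : ℕ) - 1),
        Real.exp (-(u ^ 2 * t) * (2 - 2 * Real.cos (Real.pi * (((k : ℕ) : ℝ) + 1) / ((n u : ℕ) : ℝ)))))
      atTop (nhds (∑' k : ℕ, Real.exp (-t * (((k : ℝ) + 1) ^ 2 * Real.pi ^ 2 / a ^ 2)))) := by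
  have hpi := Real.pi_pos
  have hninf : Tendsto (fun u : ℝ => ((n u : ℕ) : ℝ)) atTop atTop := by
    have := hn.pos_mul_atTop ha tendsto_id
    refine this.congr' ?_
    filter_upwards [eventually_gt_atTop 0] with u hu
    simp only [id]; field_simp
  have hrew : ∀ u : ℝ, ∑ k : Fin ((n u : ℕ) - 1),
        Real.exp (-(u ^ 2 * t) * (2 - 2 * Real.cos (Real.pi * (((k : ℕ) : ℝ) + 1) / ((n u : ℕ) : ℝ))))
      = ∑' k : ℕ, if k < (n u : ℕ) - 1 then
        Real.exp (-(u ^ 2 * t) * (2 - 2 * Real.cos (Real.pi * ((k : ℝ) + 1) / ((n u : ℕ) : ℝ)))) else 0 := by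
    intro u
    rw [Fin.sum_univ_eq_sum_range (fun k : ℕ =>
      Real.exp (-(u ^ 2 * t) * (2 - 2 * Real.cos (Real.pi * ((k : ℝ) + 1) / ((n u : ℕ) : ℝ))))),
      tsum_eq_sum (s := Finset.range ((n u : ℕ) - 1))]
    · exact Finset.sum_congr rfl (fun k hk => by rw [if_pos (Finset.mem_range.mp hk)])
    · intro k hk
      rw [if_neg (by simpa using hk)]
  simp_rw [hrew]
  refine tendsto_tsum_of_dominated_convergence
    (bound := fun k : ℕ => Real.exp (-(t / a ^ 2) * ((k : ℝ) + 1) ^ 2))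
    (summable_gauss_aux _ (by positivity)) ?_ ?_
  · intro k
    have hy : Tendsto (fun u : ℝ => Real.pi * ((k : ℝ) + 1) / ((n u : ℕ) : ℝ) / 2) atTop (nhds 0) := by
      simpa using (hninf.const_div_atTop (Real.pi * ((k : ℝ) + 1))).div_const 2
    have hs : Tendsto (fun u : ℝ => Real.sinc (Real.pi * ((k : ℝ) + 1) / ((n u : ℕ) : ℝ) / 2))
        atTop (nhds 1) := by
      have h := (Real.continuous_sinc.tendsto 0).comp hy
      rw [Real.sinc_zero] at h
      exact h
    have hm : Tendsto (fun u : ℝ => -t * ((Real.pi * ((k : ℝ) + 1) / (((n u : ℕ) : ℝ) / u)) *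
        Real.sinc (Real.pi * ((k : ℝ) + 1) / ((n u : ℕ) : ℝ) / 2)) ^ 2) atTop
        (nhds (-t * (((k : ℝ) + 1) ^ 2 * Real.pi ^ 2 / a ^ 2))) := by
      have := ((((tendsto_const_nhds (x := Real.pi * ((k : ℝ) + 1))).div hn ha.ne').mul hs).pow 2).const_mul (-t)
      rw [show -t * (((k : ℝ) + 1) ^ 2 * Real.pi ^ 2 / a ^ 2) =
        -t * (Real.pi * ((k : ℝ) + 1) / a * 1) ^ 2 by ring]
      exact this
    refine ((Real.continuous_exp.tendsto _).comp hm).congr' ?_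
    filter_upwards [eventually_gt_atTop 0, hninf.eventually_gt_atTop ((k : ℝ) + 1)] with u hu hk
    have hk' : k + 1 < (n u : ℕ) := by exact_mod_cast hk
    rw [if_pos (by omega), two_sub_two_cos_aux, sin_eq_mul_sinc_aux]
    have hnp : (0 : ℝ) < ((n u : ℕ) : ℝ) := by exact_mod_cast (n u).pos
    simp only [Function.comp]
    congr 1
    field_simp
    ring
  · have h2 : ∀ᶠ u in atTop, ((n u : ℕ) : ℝ) / u < 2 * a :=
      hn.eventually_lt_const (by linarith)
    filter_upwards [eventually_gt_atTop 0, h2] with u hu h2 k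
    split_ifs with hk
    · rw [Real.norm_eq_abs, abs_of_pos (Real.exp_pos _)]
      apply Real.exp_le_exp.mpr
      rw [two_sub_two_cos_aux]
      have hnp : (0 : ℝ) < ((n u : ℕ) : ℝ) := by exact_mod_cast (n u).pos
      have hkn : ((k : ℝ) + 1) ≤ ((n u : ℕ) : ℝ) := by
        have : k + 1 ≤ (n u : ℕ) := by omega
        exact_mod_cast this
      have h3 : ((n u : ℕ) : ℝ) < 2 * a * u := by rwa [div_lt_iff₀ hu] at h2
      have h4 := Real.mul_le_sin (x := Real.pi * ((k : ℝ) + 1) / ((n u : ℕ) : ℝ) / 2)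
        (by positivity) (by
          have : Real.pi * ((k : ℝ) + 1) / ((n u : ℕ) : ℝ) ≤ Real.pi := by
            rw [div_le_iff₀ hnp]; gcongr
          linarith)
      have h5 : ((k : ℝ) + 1) / (2 * a) ≤
          u * Real.sin (Real.pi * ((k : ℝ) + 1) / ((n u : ℕ) : ℝ) / 2) := by
        calc ((k : ℝ) + 1) / (2 * a) ≤ u * (((k : ℝ) + 1) / ((n u : ℕ) : ℝ)) := by
              rw [← mul_div_assoc, div_le_div_iff₀ (by positivity) hnp]
              nlinarith [mul_le_mul_of_nonneg_left h3.le (by positivity : (0 : ℝ) ≤ (k : ℝ) + 1)]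
          _ = u * (2 / Real.pi * (Real.pi * ((k : ℝ) + 1) / ((n u : ℕ) : ℝ) / 2)) := by
              field_simp
          _ ≤ _ := by gcongr
      have h6 := pow_le_pow_left₀ (by positivity) h5 2
      have h7 := mul_le_mul_of_nonneg_left h6 (by positivity : (0 : ℝ) ≤ 4 * t)
      have h8 : 4 * t * (((k : ℝ) + 1) / (2 * a)) ^ 2 = t / a ^ 2 * ((k : ℝ) + 1) ^ 2 := by
        field_simp; ring
      rw [h8] at h7
      nlinarith [h7]
    · simpa using (Real.exp_pos _).le

theorem discrete_theta_tendsto_continuum_theta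
    (d : ℕ) (hd : 1 ≤ d) (a : Fin d → ℝ) (ha : ∀ i, 0 < a i)
    (n : Fin d → ℝ → ℕ+)
    (hn : ∀ i, Filter.Tendsto (fun u : ℝ => ((n i u : ℕ) : ℝ) / u) atTop (nhds (a i)))
    (t : ℝ) (ht : 0 < t) :
    Filter.Tendsto (fun u : ℝ => ThetaL d (fun i => (n i u : ℕ)) (u ^ 2 * t))
      atTop (nhds (thetaK d a t)) := by
  have hL : ∀ u : ℝ, ThetaL d (fun i => (n i u : ℕ)) (u ^ 2 * t) =
      ∏ i, ∑ k : Fin ((n i u : ℕ) - 1), Real.exp (-(u ^ 2 * t) *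
        (2 - 2 * Real.cos (Real.pi * (((k : ℕ) : ℝ) + 1) / ((n i u : ℕ) : ℝ)))) := by
    intro u
    rw [Fintype.prod_sum]
    unfold ThetaL
    refine Finset.sum_congr rfl (fun q _ => ?_)
    rw [← Real.exp_sum, ← Finset.mul_sum, Finset.sum_sub_distrib, ← Finset.mul_sum]
    simp [mul_comm]
  have hK : thetaK d a t =
      ∏ i, ∑' k : ℕ, Real.exp (-t * (((k : ℝ) + 1) ^ 2 * Real.pi ^ 2 / (a i) ^ 2)) := by
    have h1 : ∀ i, HasSum (fun q : ℕ+ => Real.exp (-t * (((q : ℕ) : ℝ) ^ 2 * Real.pi ^ 2 / (a i) ^ 2)))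
        (∑' k : ℕ, Real.exp (-t * (((k : ℝ) + 1) ^ 2 * Real.pi ^ 2 / (a i) ^ 2))) := by
      intro i
      have hai := ha i
      have hpi := Real.pi_pos
      have hs : Summable (fun k : ℕ =>
          Real.exp (-t * (((k : ℝ) + 1) ^ 2 * Real.pi ^ 2 / (a i) ^ 2))) := by
        refine (summable_gauss_aux (t * Real.pi ^ 2 / (a i) ^ 2) (by positivity)).congr (fun k => ?_)
        congr 1; ring
      refine (Equiv.hasSum_iff Equiv.pnatEquivNat.symm).mp ?_
      convert hs.hasSum using 2
      simp
    have h2 := hasSum_pi_aux d _ _ (fun i b => (Real.exp_pos _).le) h1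
    rw [← h2.tsum_eq]
    unfold thetaK
    refine tsum_congr (fun q => ?_)
    rw [← Real.exp_sum, ← Finset.mul_sum]
  simp_rw [hL]
  rw [hK]
  exact tendsto_finsetProd _ (fun i _ => one_dim_aux (a i) (ha i) (n i) (hn i) t ht)
end

section
/- Let d ≥ 1 and let m̃ ≥ 0. Then the function ℒ_{m̃}(s) := −∫₀^∞ (e^{−s²t} e^{−m̃²t} e^{−2dt} I₀(2t)^d − e^{−t}) dt/t is well defined for every real s > 0 (the integral converges absolutely), and ℒ_{m̃}(s) − log(s²) tends to 0 as s → +∞. -/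
open Real Filter Finset MeasureTheory

/-- The integrand of `ℒ_m̃(s)`. -/
noncomputable def Lmintegrand (d : ℕ) (mt s t : ℝ) : ℝ :=
  (Real.exp (-s ^ 2 * t) * Real.exp (-mt ^ 2 * t) * Real.exp (-2 * d * t) *
      (besselI0 (2 * t)) ^ d - Real.exp (-t)) / t

/-- The function `ℒ_m̃(s)`. -/
noncomputable def Lmfun (d : ℕ) (mt : ℝ) (s : ℝ) : ℝ :=
  -∫ t in Set.Ioi (0:ℝ), Lmintegrand d mt s t

lemma besselI0_cont : Continuous besselI0 := by
  unfold besselI0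
  refine continuous_const.mul ?_
  apply intervalIntegral.continuous_parametric_intervalIntegral_of_continuous'
  simp only [Function.uncurry_def]
  fun_prop

lemma besselI0_bounds (x : ℝ) (hx : 0 ≤ x) :
    Real.exp (-x) ≤ besselI0 x ∧ besselI0 x ≤ Real.exp x := by
  have hpi := Real.pi_pos
  have hi : IntervalIntegrable (fun θ => Real.exp (x * Real.cos θ)) volume 0 Real.pi :=
    Continuous.intervalIntegrable (by fun_prop) _ _
  have h1 : ∫ θ in (0:ℝ)..Real.pi, Real.exp (-x) ≤
      ∫ θ in (0:ℝ)..Real.pi, Real.exp (x * Real.cos θ) := by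
    refine intervalIntegral.integral_mono_on hpi.le (by simp) hi ?_
    intro θ _
    apply Real.exp_le_exp.2
    nlinarith [Real.neg_one_le_cos θ]
  have h2 : ∫ θ in (0:ℝ)..Real.pi, Real.exp (x * Real.cos θ) ≤
      ∫ θ in (0:ℝ)..Real.pi, Real.exp x := by
    refine intervalIntegral.integral_mono_on hpi.le hi (by simp) ?_
    intro θ _
    apply Real.exp_le_exp.2
    nlinarith [Real.cos_le_one θ]
  simp only [intervalIntegral.integral_const, sub_zero, smul_eq_mul] at h1 h2
  unfold besselI0
  rw [one_div_mul_eq_div]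
  constructor
  · rw [le_div_iff₀ hpi]; linarith
  · rw [div_le_iff₀ hpi]; linarith

/-- The heat-kernel factor. -/
noncomputable def heatG (d : ℕ) (mt t : ℝ) : ℝ :=
  Real.exp (-mt ^ 2 * t) * Real.exp (-2 * d * t) * (besselI0 (2 * t)) ^ d

lemma heatG_cont (d : ℕ) (mt : ℝ) : Continuous (heatG d mt) := by
  unfold heatG
  have := besselI0_cont
  fun_prop

lemma heatG_bounds (d : ℕ) (mt t : ℝ) (ht : 0 ≤ t) :
    heatG d mt t ≤ 1 ∧ 1 - heatG d mt t ≤ (mt ^ 2 + 4 * d) * t := by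
  obtain ⟨h1, h2⟩ := besselI0_bounds (2 * t) (by linarith)
  have p1 : Real.exp (-(2 * t)) ^ d ≤ besselI0 (2 * t) ^ d :=
    pow_le_pow_left₀ (Real.exp_pos _).le h1 d
  have p2 : besselI0 (2 * t) ^ d ≤ Real.exp (2 * t) ^ d :=
    pow_le_pow_left₀ ((Real.exp_pos _).le.trans h1) h2 d
  rw [← Real.exp_nat_mul] at p1 p2
  have e : 0 ≤ Real.exp (-mt ^ 2 * t) * Real.exp (-2 * d * t) := by positivity
  have q1 := mul_le_mul_of_nonneg_left p1 e
  have q2 := mul_le_mul_of_nonneg_left p2 e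
  rw [← Real.exp_add, ← Real.exp_add] at q1 q2
  have r1 := Real.add_one_le_exp (-mt ^ 2 * t + -2 * d * t + d * -(2 * t))
  have r2 : Real.exp (-mt ^ 2 * t + -2 * d * t + d * (2 * t)) ≤ 1 := by
    apply Real.exp_le_one_iff.2
    nlinarith [mul_nonneg (sq_nonneg mt) ht]
  unfold heatG
  rw [← Real.exp_add]
  constructor <;> nlinarith

lemma expdiff_bound (a t : ℝ) (ht : 0 < t) :
    |(Real.exp (-a * t) - Real.exp (-t)) / t| ≤
      |a - 1| * (Real.exp (-a * t) + Real.exp (-1 * t)) := by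
  have x := Real.exp_pos (-a * t)
  have y := Real.exp_pos (-t)
  rw [neg_one_mul, abs_div, abs_of_pos ht, div_le_iff₀ ht]
  have k1 := Real.add_one_le_exp ((a - 1) * t)
  have k2 := Real.add_one_le_exp (-((a - 1) * t))
  have e1 : Real.exp (-a * t) * Real.exp ((a - 1) * t) = Real.exp (-t) := by
    rw [← Real.exp_add]; ring_nf
  have e2 : Real.exp (-t) * Real.exp (-((a - 1) * t)) = Real.exp (-a * t) := by
    rw [← Real.exp_add]; ring_nf
  have l1 := mul_le_mul_of_nonneg_left k1 x.le
  have l2 := mul_le_mul_of_nonneg_left k2 y.le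
  rw [e1] at l1
  rw [e2] at l2
  have xt := mul_pos x ht
  have yt := mul_pos y ht
  have m1 := mul_le_mul_of_nonneg_right (le_abs_self (a - 1)) xt.le
  have m2 := mul_le_mul_of_nonneg_right (neg_abs_le (a - 1)) xt.le
  have m3 := mul_le_mul_of_nonneg_right (le_abs_self (a - 1)) yt.le
  have m4 := mul_le_mul_of_nonneg_right (neg_abs_le (a - 1)) yt.le
  have n1 := mul_nonneg (abs_nonneg (a - 1)) xt.le
  have n2 := mul_nonneg (abs_nonneg (a - 1)) yt.le
  rw [abs_le]
  constructor <;> nlinarith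

lemma expdiff_int (a : ℝ) (ha : 0 < a) :
    IntegrableOn (fun t => (Real.exp (-a * t) - Real.exp (-t)) / t) (Set.Ioi 0) := by
  have h : IntegrableOn (fun t => |a - 1| * (Real.exp (-a * t) + Real.exp (-1 * t)))
      (Set.Ioi 0) :=
    ((exp_neg_integrableOn_Ioi 0 ha).add (exp_neg_integrableOn_Ioi 0 one_pos)).const_mul _
  refine Integrable.mono' h ?_ ?_
  · exact Measurable.aestronglyMeasurable (by fun_prop)
  · filter_upwards [ae_restrict_mem measurableSet_Ioi] with t ht
    exact expdiff_bound a t ht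

lemma expdiff_integral (a : ℝ) (ha : 0 < a) :
    ∫ t in Set.Ioi (0:ℝ), (Real.exp (-a * t) - Real.exp (-t)) / t = - Real.log a := by
  have hc : Continuous (fun x : ℝ => Real.exp (-x)) := by fun_prop
  have hL : Tendsto (fun x : ℝ => Real.exp (-x)) (nhdsWithin 0 (Set.Ioi 0)) (nhds 1) := by
    have := (hc.tendsto 0).mono_left (nhdsWithin_le_nhds (s := Set.Ioi 0))
    simpa using this
  have heq : (fun x : ℝ => x⁻¹ • (Real.exp (-(a * x)) - Real.exp (-(1 * x)))) =
      fun t => (Real.exp (-a * t) - Real.exp (-t)) / t := by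
    funext x
    simp only [smul_eq_mul, one_mul, neg_mul]
    rw [inv_mul_eq_div]
  have := Frullani.integral_Ioi_eq (f := fun x : ℝ => Real.exp (-x)) (a := a) (b := 1)
    (L := 1) (R := 0) (hc.locallyIntegrable.locallyIntegrableOn _) ha one_pos hL
    Real.tendsto_exp_neg_atTop_nhds_zero (by rw [heq]; exact expdiff_int a ha)
  rw [heq] at this
  rw [this]
  simp

lemma rem_bound (d : ℕ) (mt a t : ℝ) (ht : 0 < t) :
    0 ≤ Real.exp (-a * t) * (1 - heatG d mt t) / t ∧
    Real.exp (-a * t) * (1 - heatG d mt t) / t ≤ (mt ^ 2 + 4 * d) * Real.exp (-a * t) := by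
  obtain ⟨h1, h2⟩ := heatG_bounds d mt t ht.le
  have x := Real.exp_pos (-a * t)
  constructor
  · exact div_nonneg (mul_nonneg x.le (by linarith)) ht.le
  · rw [div_le_iff₀ ht]
    nlinarith

lemma rem_int (d : ℕ) (mt a : ℝ) (ha : 0 < a) :
    IntegrableOn (fun t => Real.exp (-a * t) * (1 - heatG d mt t) / t) (Set.Ioi 0) := by
  have h := (exp_neg_integrableOn_Ioi 0 ha).const_mul (mt ^ 2 + 4 * d)
  have hm := (heatG_cont d mt).measurable
  refine Integrable.mono' h ?_ ?_
  · exact Measurable.aestronglyMeasurable (by fun_prop)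
  · filter_upwards [ae_restrict_mem measurableSet_Ioi] with t ht
    obtain ⟨h1, h2⟩ := rem_bound d mt a t ht
    rw [Real.norm_of_nonneg h1]
    exact h2

lemma Lmintegrand_split (d : ℕ) (mt s : ℝ) :
    (fun t => Lmintegrand d mt s t) = fun t =>
      (Real.exp (-s ^ 2 * t) - Real.exp (-t)) / t -
        Real.exp (-s ^ 2 * t) * (1 - heatG d mt t) / t := by
  funext t
  unfold Lmintegrand heatG
  ring

lemma Lmfun_eq (d : ℕ) (mt s : ℝ) (hs : 0 < s) :
    Lmfun d mt s - Real.log (s ^ 2) =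
      ∫ t in Set.Ioi (0:ℝ), Real.exp (-s ^ 2 * t) * (1 - heatG d mt t) / t := by
  have ha : 0 < s ^ 2 := by positivity
  unfold Lmfun
  rw [Lmintegrand_split, integral_sub (expdiff_int _ ha) (rem_int d mt _ ha),
    expdiff_integral _ ha]
  ring

theorem Lm_well_defined_and_asymptotics (d : ℕ) (hd : 1 ≤ d) (mt : ℝ) (hmt : 0 ≤ mt) :
    (∀ s : ℝ, 0 < s → IntegrableOn (fun t => Lmintegrand d mt s t) (Set.Ioi 0)) ∧
    Filter.Tendsto (fun s : ℝ => Lmfun d mt s - Real.log (s ^ 2)) atTop (nhds 0) := by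
  constructor
  · intro s hs
    have ha : 0 < s ^ 2 := by positivity
    rw [Lmintegrand_split]
    exact (expdiff_int _ ha).sub (rem_int d mt _ ha)
  · have hlim : Tendsto (fun s : ℝ => (mt ^ 2 + 4 * d) / s ^ 2) atTop (nhds 0) :=
      tendsto_const_nhds.div_atTop (tendsto_pow_atTop two_ne_zero)
    refine tendsto_of_tendsto_of_tendsto_of_le_of_le' tendsto_const_nhds hlim ?_ ?_
    · filter_upwards [eventually_gt_atTop 0] with s hs
      rw [Lmfun_eq d mt s hs]
      exact setIntegral_nonneg measurableSet_Ioi fun t ht => (rem_bound d mt _ t ht).1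
    · filter_upwards [eventually_gt_atTop 0] with s hs
      have ha : 0 < s ^ 2 := by positivity
      rw [Lmfun_eq d mt s hs]
      calc _ ≤ ∫ t in Set.Ioi (0:ℝ), (mt ^ 2 + 4 * d) * Real.exp (-s ^ 2 * t) :=
            setIntegral_mono_on (rem_int d mt _ ha)
              ((exp_neg_integrableOn_Ioi 0 ha).const_mul _) measurableSet_Ioi
              fun t ht => (rem_bound d mt _ t ht).2
        _ = _ := by
            rw [integral_const_mul, integral_exp_mul_Ioi (by linarith)]
            simp [div_eq_mul_inv]
end

section
/- Let d ≥ 2 be an integer and let a, b be real numbers with a ≥ b ≥ 0 and a + b < d. Then the improper integral ∫₀^∞ m̃^{a−b} e^{−m̃²t} e^{−2dt} I₀(2t)^d t^{a−1} dt converges uniformly in m̃ ∈ [0,1]: for every ε > 0 there exists A > 0 such that for all m̃ ∈ [0,1], |∫_A^∞ m̃^{a−b} e^{−m̃²t} e^{−2dt} I₀(2t)^d t^{a−1} dt| < ε. -/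
open Real Filter Finset MeasureTheory

lemma besselI0_nonneg_aux (x : ℝ) : 0 ≤ besselI0 x := by
  unfold besselI0
  have := intervalIntegral.integral_nonneg (μ := volume) (f := fun θ => Real.exp (x * Real.cos θ))
    Real.pi_pos.le (fun θ _ => (Real.exp_pos _).le)
  have := Real.pi_pos
  positivity

lemma besselI0_bound_aux (t : ℝ) (ht : 0 < t) :
    Real.exp (-2 * t) * besselI0 (2 * t) ≤ t ^ (-(1/2) : ℝ) := by
  have hpi := Real.pi_pos
  have hb : 0 < 4 * t / π ^ 2 := by positivity
  have hint := integrable_exp_neg_mul_sq hb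
  have h1 : Real.exp (-2 * t) * (∫ θ in (0:ℝ)..Real.pi, Real.exp (2 * t * Real.cos θ))
      ≤ ∫ θ in (0:ℝ)..Real.pi, Real.exp (-(4 * t / π ^ 2) * θ ^ 2) := by
    rw [← intervalIntegral.integral_const_mul]
    apply intervalIntegral.integral_mono_on hpi.le
    · apply Continuous.intervalIntegrable; fun_prop
    · apply Continuous.intervalIntegrable; fun_prop
    · intro θ hθ
      rw [← Real.exp_add]
      apply Real.exp_le_exp.mpr
      have := Real.cos_le_one_sub_mul_cos_sq (x := θ) (by rw [abs_of_nonneg hθ.1]; exact hθ.2)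
      have h2 := mul_le_mul_of_nonneg_left this (by positivity : 0 ≤ 2 * t)
      have h3 : 2 * t * (1 - 2 / π ^ 2 * θ ^ 2) = 2 * t - (4 * t / π ^ 2) * θ ^ 2 := by ring
      linarith
  have h2 : ∫ θ in (0:ℝ)..Real.pi, Real.exp (-(4 * t / π ^ 2) * θ ^ 2)
      ≤ √(π / (4 * t / π ^ 2)) := by
    rw [← integral_gaussian, intervalIntegral.integral_of_le hpi.le]
    exact setIntegral_le_integral hint (Eventually.of_forall fun _ => (Real.exp_pos _).le)
  have h3 : √(π / (4 * t / π ^ 2)) ≤ π * t ^ (-(1/2) : ℝ) := by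
    rw [Real.rpow_neg ht.le, ← Real.sqrt_eq_rpow, ← Real.sqrt_inv]
    apply Real.sqrt_le_iff.mpr
    refine ⟨by positivity, ?_⟩
    rw [mul_pow, Real.sq_sqrt (by positivity)]
    have : π / (4 * t / π ^ 2) = π ^ 2 * t⁻¹ * (π / 4) := by field_simp
    rw [this]
    apply mul_le_of_le_one_right (by positivity)
    linarith [Real.pi_le_four]
  unfold besselI0
  calc _ = (1 / π) * (Real.exp (-2 * t) * (∫ θ in (0:ℝ)..Real.pi, Real.exp (2 * t * Real.cos θ))) := by ring
    _ ≤ (1 / π) * (π * t ^ (-(1/2) : ℝ)) := by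
      apply mul_le_mul_of_nonneg_left _ (by positivity)
      linarith
    _ = _ := by field_simp

lemma rpow_mul_exp_bound_aux (p : ℝ) (hp : 0 ≤ p) :
    ∃ K : ℝ, 0 < K ∧ ∀ s : ℝ, 0 ≤ s → s ^ p * Real.exp (-s) ≤ K := by
  obtain ⟨n, hn⟩ := exists_nat_ge p
  refine ⟨1 + n.factorial, by positivity, fun s hs => ?_⟩
  have h1 : s ^ p ≤ 1 + s ^ n := by
    rcases le_total s 1 with h | h
    · have := Real.rpow_le_one hs h hp
      have : 0 ≤ s ^ n := by positivity
      linarith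
    · have := Real.rpow_le_rpow_of_exponent_le h hn
      rw [Real.rpow_natCast] at this
      linarith
  have h2 := Real.pow_div_factorial_le_exp s hs n
  rw [div_le_iff₀ (by positivity)] at h2
  have h3 : 1 ≤ Real.exp s := Real.one_le_exp hs
  rw [Real.exp_neg, ← div_eq_mul_inv, div_le_iff₀ (Real.exp_pos _)]
  linarith

theorem uniform_convergence_of_mass_integral
    (d : ℕ) (hd : 2 ≤ d) (a b : ℝ) (hb : 0 ≤ b) (hba : b ≤ a) (hab : a + b < d) :
    ∀ ε : ℝ, 0 < ε → ∃ A : ℝ, 0 < A ∧ ∀ m : ℝ, m ∈ Set.Icc (0:ℝ) 1 →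
      |∫ t in Set.Ioi A, m ^ (a - b) * Real.exp (-m ^ 2 * t) * Real.exp (-2 * d * t) *
        (besselI0 (2 * t)) ^ d * t ^ (a - 1)| < ε := by
  intro ε hε
  obtain ⟨K, hK, hKb⟩ := rpow_mul_exp_bound_aux ((a - b) / 2) (by linarith)
  set q : ℝ := (d - (a + b)) / 2 with hq
  have hq0 : 0 < q := by rw [hq]; linarith
  have hlim : Tendsto (fun A : ℝ => K * (A ^ (-q) / q)) atTop (nhds 0) := by
    simpa using ((tendsto_rpow_neg_atTop hq0).div_const q).const_mul K
  obtain ⟨A, hA0, hA⟩ := ((eventually_gt_atTop (0:ℝ)).and (hlim.eventually (gt_mem_nhds hε))).exists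
  refine ⟨A, hA0, fun m hm => ?_⟩
  have hint : IntegrableOn (fun t : ℝ => K * t ^ (-q - 1)) (Set.Ioi A) :=
    (integrableOn_Ioi_rpow_of_lt (by linarith) hA0).const_mul K
  refine lt_of_le_of_lt ?_ hA
  have hval : ∫ t in Set.Ioi A, K * t ^ (-q - 1) = K * (A ^ (-q) / q) := by
    rw [integral_const_mul, integral_Ioi_rpow_of_lt (by linarith) hA0]
    congr 1
    rw [sub_add_cancel, neg_div_neg_eq]
  rw [← hval, ← Real.norm_eq_abs]
  apply norm_integral_le_of_norm_le hint
  filter_upwards [self_mem_ae_restrict measurableSet_Ioi] with t ht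
  have ht0 : 0 < t := hA0.trans ht
  have hB := besselI0_nonneg_aux (2 * t)
  have hm0 := hm.1
  rw [Real.norm_of_nonneg (by positivity)]
  have e1 : Real.exp (-2 * d * t) * (besselI0 (2 * t)) ^ d ≤ t ^ (-(d:ℝ) / 2) := by
    have := pow_le_pow_left₀ (by positivity) (besselI0_bound_aux t ht0) d
    rw [mul_pow, ← Real.exp_nat_mul, ← Real.rpow_mul_natCast ht0.le] at this
    have r1 : (-2 * d * t : ℝ) = d * (-2 * t) := by ring
    have r2 : (-(d:ℝ) / 2) = -(1 / 2) * d := by ring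
    rw [r1, r2]
    exact this
  have e2 : m ^ (a - b) * Real.exp (-m ^ 2 * t) ≤ K * t ^ (-((a - b) / 2)) := by
    have := hKb (m ^ 2 * t) (by positivity)
    rw [Real.mul_rpow (by positivity) ht0.le, ← Real.rpow_natCast_mul hm0] at this
    have h2 : ((2:ℕ):ℝ) * ((a - b) / 2) = a - b := by push_cast; ring
    rw [h2] at this
    rw [Real.rpow_neg ht0.le, ← div_eq_mul_inv, le_div_iff₀ (by positivity), neg_mul]
    linarith
  calc _ = (m ^ (a - b) * Real.exp (-m ^ 2 * t)) * (Real.exp (-2 * d * t) *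
        (besselI0 (2 * t)) ^ d) * t ^ (a - 1) := by ring
    _ ≤ (K * t ^ (-((a - b) / 2))) * t ^ (-(d:ℝ) / 2) * t ^ (a - 1) := by gcongr
    _ = K * t ^ (-q - 1) := by
      rw [mul_assoc, mul_assoc, ← Real.rpow_add ht0, ← Real.rpow_add ht0]
      congr 2
      rw [hq]; ring
end
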